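/- Let κ, ℓ > 0 be real, n ∈ ℕ, and let f, g : ℍ → ℂ be smooth functions satisfying Δ_κ f = 0 and Δ_ℓ g = 0. Then, pointwise on ℍ, (−4π)^n·L_{κ+ℓ+2n}([f,g]_n) = (Γ(κ+n)/(Γ(n+1)·Γ(κ)))·(L_κ f)·(R_ℓⁿ g) + (−1)^n·(Γ(ℓ+n)/(Γ(n+1)·Γ(ℓ)))·(R_κⁿ f)·(L_ℓ g). -/

import Mathlib

noncomputable section

/-- The partial derivative `∂_u` in the real direction `1`. -/
def du (f : ℂ → ℂ) (z : ℂ) : ℂ := fderiv ℝ f z 1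

/-- The partial derivative `∂_v` in the imaginary direction `i`. -/
def dv (f : ℂ → ℂ) (z : ℂ) : ℂ := fderiv ℝ f z Complex.I

/-- The Wirtinger derivative `∂_τ = (1/2)(∂_u − i∂_v)`. -/
def dtau (f : ℂ → ℂ) (z : ℂ) : ℂ := (1 / 2) * (du f z - Complex.I * dv f z)

/-- The Wirtinger derivative `∂_τ̄ = (1/2)(∂_u + i∂_v)`. -/
def dtaubar (f : ℂ → ℂ) (z : ℂ) : ℂ := (1 / 2) * (du f z + Complex.I * dv f z)

/-- The Maass lowering operator `L_κ = −2iv²·∂_τ̄`. -/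
def lowerOp (κ : ℝ) (f : ℂ → ℂ) : ℂ → ℂ :=
  fun z => -2 * Complex.I * (z.im ^ 2 : ℝ) * dtaubar f z

/-- The Maass raising operator `R_κ = 2i∂_τ + κ/v`. -/
def raiseOp (κ : ℝ) (f : ℂ → ℂ) : ℂ → ℂ :=
  fun z => 2 * Complex.I * dtau f z + ((κ / z.im : ℝ) : ℂ) * f z

/-- The iterated raising operator `R_κⁿ = R_{κ+2n−2} ∘ ⋯ ∘ R_{κ+2} ∘ R_κ`. -/
def raiseIter (κ : ℝ) : ℕ → (ℂ → ℂ) → (ℂ → ℂ)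
  | 0, f => f
  | n + 1, f => raiseOp (κ + 2 * n) (raiseIter κ n f)

/-- The iterated Wirtinger derivative `∂_τ^r`. -/
def dtauIter : ℕ → (ℂ → ℂ) → (ℂ → ℂ)
  | 0, f => f
  | r + 1, f => dtau (dtauIter r f)

/-- The `n`-th Rankin–Cohen bracket
`[f,g]_n = (2πi)^{−n} ∑_{r+s=n} (−1)^r Γ(κ+n)Γ(ℓ+n)/(Γ(s+1)Γ(κ+n−s)Γ(r+1)Γ(ℓ+n−r))
∂_τ^r f · ∂_τ^s g`. -/
def rcBracket (κ ℓ : ℝ) (n : ℕ) (f g : ℂ → ℂ) : ℂ → ℂ := fun z =>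
  (2 * (Real.pi : ℂ) * Complex.I) ^ (-(n : ℤ)) *
    ∑ r ∈ Finset.range (n + 1),
      (((-1 : ℝ) ^ r * (Real.Gamma (κ + n) * Real.Gamma (ℓ + n)) /
          (Real.Gamma ((n - r : ℕ) + 1) * Real.Gamma (κ + n - ((n - r : ℕ) : ℝ)) *
            Real.Gamma (r + 1) * Real.Gamma (ℓ + n - r)) : ℝ) : ℂ) *
        dtauIter r f z * dtauIter (n - r) g z

/-- The weight-`κ` hyperbolic Laplace operator `Δ_κ`. -/
def laplaceOp (κ : ℝ) (f : ℂ → ℂ) (z : ℂ) : ℂ :=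
  -(z.im ^ 2 : ℝ) * (du (du f) z + dv (dv f) z) +
    Complex.I * (κ : ℂ) * (z.im : ℝ) * (du f z + Complex.I * dv f z)

open Complex in
theorem isOpen_upperHalf : IsOpen {z : ℂ | 0 < z.im} :=
  isOpen_lt continuous_const continuous_im

theorem dtau_congr {f g : ℂ → ℂ} (h : ∀ z : ℂ, 0 < z.im → f z = g z) {z : ℂ}
    (hz : 0 < z.im) : dtau f z = dtau g z := by
  have : f =ᶠ[nhds z] g := Filter.eventually_of_mem (isOpen_upperHalf.mem_nhds hz) h
  simp only [dtau, du, dv, this.fderiv_eq]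

theorem dtau_mul {f g : ℂ → ℂ} {z : ℂ} (hf : DifferentiableAt ℝ f z)
    (hg : DifferentiableAt ℝ g z) :
    dtau (fun w => f w * g w) z = dtau f z * g z + f z * dtau g z := by
  simp only [dtau, du, dv, fderiv_fun_mul hf hg]
  simp
  ring

theorem dtaubar_mul {f g : ℂ → ℂ} {z : ℂ} (hf : DifferentiableAt ℝ f z)
    (hg : DifferentiableAt ℝ g z) :
    dtaubar (fun w => f w * g w) z = dtaubar f z * g z + f z * dtaubar g z := by
  simp only [dtaubar, du, dv, fderiv_fun_mul hf hg]
  simp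
  ring

theorem dtau_const_mul (c : ℂ) {f : ℂ → ℂ} {z : ℂ} (hf : DifferentiableAt ℝ f z) :
    dtau (fun w => c * f w) z = c * dtau f z := by
  rw [dtau_mul (differentiableAt_const c) hf]
  simp [dtau, du, dv]

theorem dtaubar_const_mul (c : ℂ) {f : ℂ → ℂ} {z : ℂ} (hf : DifferentiableAt ℝ f z) :
    dtaubar (fun w => c * f w) z = c * dtaubar f z := by
  rw [dtaubar_mul (differentiableAt_const c) hf]
  simp [dtaubar, du, dv]

theorem dtau_sum {ι : Type*} (s : Finset ι) {F : ι → ℂ → ℂ} {z : ℂ}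
    (hF : ∀ i ∈ s, DifferentiableAt ℝ (F i) z) :
    dtau (fun w => ∑ i ∈ s, F i w) z = ∑ i ∈ s, dtau (F i) z := by
  simp only [dtau, du, dv, fderiv_fun_sum hF]
  simp [Finset.mul_sum, ← Finset.sum_sub_distrib]

theorem dtaubar_sum {ι : Type*} (s : Finset ι) {F : ι → ℂ → ℂ} {z : ℂ}
    (hF : ∀ i ∈ s, DifferentiableAt ℝ (F i) z) :
    dtaubar (fun w => ∑ i ∈ s, F i w) z = ∑ i ∈ s, dtaubar (F i) z := by
  simp only [dtaubar, du, dv, fderiv_fun_sum hF]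
  simp [Finset.mul_sum, ← Finset.sum_add_distrib]

theorem hasFDerivAt_im_zpow (k : ℤ) {z : ℂ} (hz : 0 < z.im) :
    HasFDerivAt (fun w : ℂ => (w.im : ℂ) ^ k)
      (((k : ℂ) * (z.im : ℂ) ^ (k - 1)) • (Complex.ofRealCLM.comp Complex.imCLM)) z := by
  have h := (hasDerivAt_zpow k (z.im : ℂ) (Or.inl (by exact_mod_cast hz.ne'))).hasFDerivAt
  have h2 := (h.restrictScalars ℝ).comp z
    (Complex.ofRealCLM.comp Complex.imCLM).hasFDerivAt
  refine h2.congr_fderiv ?_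
  ext
  simp [mul_comm]

theorem dtau_im_zpow (k : ℤ) {z : ℂ} (hz : 0 < z.im) :
    dtau (fun w : ℂ => (w.im : ℂ) ^ k) z =
      -(Complex.I / 2) * k * (z.im : ℂ) ^ (k - 1) := by
  simp only [dtau, du, dv, (hasFDerivAt_im_zpow k hz).fderiv]
  simp
  ring

theorem ContDiffOn.fderiv_apply_upperHalf {f : ℂ → ℂ}
    (hf : ContDiffOn ℝ (⊤ : ℕ∞) f {z : ℂ | 0 < z.im}) (v : ℂ) :
    ContDiffOn ℝ (⊤ : ℕ∞) (fun z => fderiv ℝ f z v) {z : ℂ | 0 < z.im} :=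
  (hf.fderiv_of_isOpen isOpen_upperHalf (by simp)).clm_apply contDiffOn_const

theorem ContDiffOn.differentiableAt_upperHalf {f : ℂ → ℂ}
    (hf : ContDiffOn ℝ (⊤ : ℕ∞) f {z : ℂ | 0 < z.im}) {z : ℂ} (hz : 0 < z.im) :
    DifferentiableAt ℝ f z :=
  (hf.contDiffAt (isOpen_upperHalf.mem_nhds hz)).differentiableAt (by simp)

theorem ContDiffOn.dtau_upperHalf {f : ℂ → ℂ}
    (hf : ContDiffOn ℝ (⊤ : ℕ∞) f {z : ℂ | 0 < z.im}) :
    ContDiffOn ℝ (⊤ : ℕ∞) (dtau f) {z : ℂ | 0 < z.im} :=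
  contDiffOn_const.mul
    ((hf.fderiv_apply_upperHalf 1).sub
      (contDiffOn_const.mul (hf.fderiv_apply_upperHalf Complex.I)))

theorem ContDiffOn.dtaubar_upperHalf {f : ℂ → ℂ}
    (hf : ContDiffOn ℝ (⊤ : ℕ∞) f {z : ℂ | 0 < z.im}) :
    ContDiffOn ℝ (⊤ : ℕ∞) (dtaubar f) {z : ℂ | 0 < z.im} :=
  contDiffOn_const.mul
    ((hf.fderiv_apply_upperHalf 1).add
      (contDiffOn_const.mul (hf.fderiv_apply_upperHalf Complex.I)))

theorem ContDiffOn.dtauIter_upperHalf {f : ℂ → ℂ}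
    (hf : ContDiffOn ℝ (⊤ : ℕ∞) f {z : ℂ | 0 < z.im}) (r : ℕ) :
    ContDiffOn ℝ (⊤ : ℕ∞) (dtauIter r f) {z : ℂ | 0 < z.im} := by
  induction r with
  | zero => exact hf
  | succ r ih => exact ih.dtau_upperHalf

/-- The mixed second partial derivatives of a smooth function agree. -/
theorem du_dv_comm {f : ℂ → ℂ} (hf : ContDiffOn ℝ (⊤ : ℕ∞) f {z : ℂ | 0 < z.im})
    {z : ℂ} (hz : 0 < z.im) : du (dv f) z = dv (du f) z := by
  have hs : IsSymmSndFDerivAt ℝ f z :=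
    (hf.contDiffAt (isOpen_upperHalf.mem_nhds hz)).isSymmSndFDerivAt
      (by simpa using WithTop.coe_le_coe.2 (le_top : (2 : ℕ∞) ≤ ⊤))
  have hd : DifferentiableAt ℝ (fderiv ℝ f) z :=
    ((hf.fderiv_of_isOpen isOpen_upperHalf (m := (⊤ : ℕ∞)) (by simp)).contDiffAt
      (isOpen_upperHalf.mem_nhds hz)).differentiableAt (by simp)
  have key (v w : ℂ) : fderiv ℝ (fun y => fderiv ℝ f y v) z w
      = fderiv ℝ (fderiv ℝ f) z w v := by
    rw [fderiv_clm_apply hd (differentiableAt_const v)]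
    simp
  change fderiv ℝ (fun y => fderiv ℝ f y Complex.I) z 1
    = fderiv ℝ (fun y => fderiv ℝ f y 1) z Complex.I
  rw [key, key, hs.eq]

theorem fderiv_half_add_const_mul {a b : ℂ → ℂ} {z : ℂ} (c : ℂ)
    (ha : DifferentiableAt ℝ a z) (hb : DifferentiableAt ℝ b z) (v : ℂ) :
    fderiv ℝ (fun w => (1 / 2) * (a w + c * b w)) z v =
      (1 / 2) * (fderiv ℝ a z v + c * fderiv ℝ b z v) := by
  rw [fderiv_const_mul (ha.fun_add (hb.const_mul c)),
    fderiv_fun_add ha (hb.const_mul c), fderiv_const_mul hb]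
  simp
  ring

theorem dtau_dtaubar {f : ℂ → ℂ} (hf : ContDiffOn ℝ (⊤ : ℕ∞) f {z : ℂ | 0 < z.im})
    {z : ℂ} (hz : 0 < z.im) :
    dtau (dtaubar f) z = (1 / 4) * (du (du f) z + dv (dv f) z) := by
  have hu := (hf.fderiv_apply_upperHalf 1).differentiableAt_upperHalf hz
  have hv := (hf.fderiv_apply_upperHalf Complex.I).differentiableAt_upperHalf hz
  have e (v : ℂ) : fderiv ℝ (dtaubar f) z v =
      (1 / 2) * (fderiv ℝ (du f) z v + Complex.I * fderiv ℝ (dv f) z v) :=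
    fderiv_half_add_const_mul Complex.I hu hv v
  have c := du_dv_comm hf hz
  simp only [du, dv] at c
  simp only [dtau, du, dv] at e ⊢
  rw [e, e]
  linear_combination (Complex.I / 4) * c
    - (1 / 4) * fderiv ℝ (dv f) z Complex.I * Complex.I_sq

theorem dtaubar_dtau {f : ℂ → ℂ} (hf : ContDiffOn ℝ (⊤ : ℕ∞) f {z : ℂ | 0 < z.im})
    {z : ℂ} (hz : 0 < z.im) : dtaubar (dtau f) z = dtau (dtaubar f) z := by
  have hu := (hf.fderiv_apply_upperHalf 1).differentiableAt_upperHalf hz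
  have hv := (hf.fderiv_apply_upperHalf Complex.I).differentiableAt_upperHalf hz
  have e (v : ℂ) : fderiv ℝ (dtau f) z v =
      (1 / 2) * (fderiv ℝ (du f) z v + -Complex.I * fderiv ℝ (dv f) z v) := by
    have h := fderiv_half_add_const_mul (-Complex.I) hu hv v
    simp only [neg_mul, ← sub_eq_add_neg] at h ⊢
    exact h
  have c := du_dv_comm hf hz
  rw [dtau_dtaubar hf hz]
  simp only [du, dv] at c
  simp only [dtaubar, du, dv] at e ⊢
  rw [e, e]
  linear_combination (-Complex.I / 4) * c
    - (1 / 4) * fderiv ℝ (dv f) z Complex.I * Complex.I_sq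

theorem dtau_dtaubar_of_laplaceOp_eq_zero {κ : ℝ} {f : ℂ → ℂ}
    (hf : ContDiffOn ℝ (⊤ : ℕ∞) f {z : ℂ | 0 < z.im}) {z : ℂ} (hz : 0 < z.im)
    (hΔ : laplaceOp κ f z = 0) :
    dtau (dtaubar f) z = Complex.I / 2 * κ * (z.im : ℂ)⁻¹ * dtaubar f z := by
  have hy : (z.im : ℂ) ≠ 0 := by exact_mod_cast hz.ne'
  rw [dtau_dtaubar hf hz]
  simp only [laplaceOp, dtaubar] at hΔ ⊢
  push_cast at hΔ
  field_simp
  apply mul_left_cancel₀ hy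
  linear_combination -4 * hΔ

/-- On functions annihilated by `Δ_κ`, the operator `∂_τ̄ ∂_τ^r` is a multiple of
`v^{-r} ∂_τ̄`. -/
theorem dtaubar_dtauIter {κ : ℝ} (hκ : 0 < κ) {f : ℂ → ℂ}
    (hf : ContDiffOn ℝ (⊤ : ℕ∞) f {z : ℂ | 0 < z.im})
    (hΔ : ∀ z : ℂ, 0 < z.im → laplaceOp κ f z = 0) (r : ℕ) :
    ∀ z : ℂ, 0 < z.im → dtaubar (dtauIter r f) z =
      (Complex.I / 2) ^ r * ((Real.Gamma (κ + r) / Real.Gamma κ : ℝ) : ℂ) *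
        ((z.im : ℂ) ^ (-r : ℤ) * dtaubar f z) := by
  induction r with
  | zero =>
    intro z _
    simp [dtauIter, (Real.Gamma_pos_of_pos hκ).ne']
  | succ r ih =>
    intro z hz
    have hy : (z.im : ℂ) ≠ 0 := by exact_mod_cast hz.ne'
    have hE := hf.dtaubar_upperHalf.differentiableAt_upperHalf hz
    have hp := (hasFDerivAt_im_zpow (-r : ℤ) hz).differentiableAt
    have hΓ : Real.Gamma (κ + (r + 1 : ℕ)) = (κ + r) * Real.Gamma (κ + r) := by
      rw [← Real.Gamma_add_one (by positivity)]
      push_cast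
      ring_nf
    change dtaubar (dtau (dtauIter r f)) z = _
    rw [dtaubar_dtau (hf.dtauIter_upperHalf r) hz, dtau_congr ih hz,
      dtau_const_mul _ (hp.fun_mul hE), dtau_mul hp hE, dtau_im_zpow _ hz,
      dtau_dtaubar_of_laplaceOp_eq_zero hf hz (hΔ z hz), hΓ]
    have e1 : (z.im : ℂ) ^ (-(r : ℤ) - 1) = (z.im : ℂ) ^ (-(r : ℤ)) * (z.im : ℂ)⁻¹ :=
      zpow_sub_one₀ hy _
    have e2 : (z.im : ℂ) ^ (-((r + 1 : ℕ) : ℤ)) = (z.im : ℂ) ^ (-(r : ℤ)) * (z.im : ℂ)⁻¹ := by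
      rw [← e1]; congr 1; push_cast; ring
    rw [e1, e2]
    push_cast
    ring

/-- The coefficient of `v^{s-n} (2i)^s ∂_τ^s` in the expansion of `R_κⁿ`. -/
def raiseCoeff (κ : ℝ) (n s : ℕ) : ℝ :=
  n.choose s * (Real.Gamma (κ + n) / Real.Gamma (κ + s))

theorem raiseCoeff_self {κ : ℝ} (hκ : 0 < κ) (n : ℕ) : raiseCoeff κ n n = 1 := by
  have : 0 < Real.Gamma (κ + n) := Real.Gamma_pos_of_pos (by positivity)
  simp [raiseCoeff, this.ne']

theorem raiseCoeff_succ_zero {κ : ℝ} (hκ : 0 < κ) (n : ℕ) :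
    raiseCoeff κ (n + 1) 0 = (κ + n) * raiseCoeff κ n 0 := by
  have h : Real.Gamma (κ + (n + 1 : ℕ)) = (κ + n) * Real.Gamma (κ + n) := by
    rw [← Real.Gamma_add_one (by positivity)]
    push_cast
    ring_nf
  simp only [raiseCoeff, h]
  simp
  ring

theorem raiseCoeff_succ_succ {κ : ℝ} (hκ : 0 < κ) (n s : ℕ) :
    raiseCoeff κ (n + 1) (s + 1) =
      raiseCoeff κ n s + (κ + n + (s + 1)) * raiseCoeff κ n (s + 1) := by
  have h (m : ℕ) : Real.Gamma (κ + (m + 1 : ℕ)) = (κ + m) * Real.Gamma (κ + m) := by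
    rw [← Real.Gamma_add_one (by positivity)]
    push_cast
    ring_nf
  have hs : Real.Gamma (κ + s) ≠ 0 := (Real.Gamma_pos_of_pos (by positivity)).ne'
  have hs' : κ + s ≠ 0 := by positivity
  have hc : (n.choose (s + 1) : ℝ) * (s + 1) + s * n.choose s = n * n.choose s := by
    have h1 := Nat.choose_succ_right_eq n s
    rcases le_or_gt s n with hsn | hsn
    · have h2 : (n.choose (s + 1) : ℝ) * (s + 1) = n.choose s * (n - s : ℕ) := by
        exact_mod_cast h1
      rw [h2, Nat.cast_sub hsn]
      ring
    · simp [Nat.choose_eq_zero_of_lt hsn, Nat.choose_eq_zero_of_lt (hsn.trans s.lt_succ_self)]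
  simp only [raiseCoeff, h, Nat.choose_succ_succ']
  push_cast
  field_simp
  linear_combination -hc

theorem raiseIter_eq_sum {κ : ℝ} (hκ : 0 < κ) {f : ℂ → ℂ}
    (hf : ContDiffOn ℝ (⊤ : ℕ∞) f {z : ℂ | 0 < z.im}) (n : ℕ) :
    ∀ z : ℂ, 0 < z.im → raiseIter κ n f z =
      ∑ s ∈ Finset.range (n + 1), (raiseCoeff κ n s * (2 * Complex.I) ^ s : ℂ) *
        ((z.im : ℂ) ^ (s - n : ℤ) * dtauIter s f z) := by
  induction n with
  | zero =>
    intro z _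
    have := raiseCoeff_self hκ 0
    simp [raiseIter, dtauIter, this]
  | succ n ih =>
    intro z hz
    have hy : (z.im : ℂ) ≠ 0 := by exact_mod_cast hz.ne'
    have hd (s : ℕ) := (hf.dtauIter_upperHalf s).differentiableAt_upperHalf hz
    have hp (s : ℕ) := (hasFDerivAt_im_zpow (s - n : ℤ) hz).differentiableAt
    have hstep : raiseIter κ (n + 1) f z =
        ∑ s ∈ Finset.range (n + 1),
          ((raiseCoeff κ n s * (2 * Complex.I) ^ (s + 1) : ℂ) *
            ((z.im : ℂ) ^ ((s + 1 : ℕ) - (n + 1 : ℕ) : ℤ) * dtauIter (s + 1) f z) +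
          (((κ + n + s) * raiseCoeff κ n s : ℝ) * (2 * Complex.I) ^ s : ℂ) *
            ((z.im : ℂ) ^ (s - (n + 1 : ℕ) : ℤ) * dtauIter s f z)) := by
      change 2 * Complex.I * dtau (raiseIter κ n f) z +
        (((κ + 2 * n) / z.im : ℝ) : ℂ) * raiseIter κ n f z = _
      rw [dtau_congr ih hz, ih z hz,
        dtau_sum _ fun s _ => ((hp s).fun_mul (hd s)).const_mul _, Finset.mul_sum,
        Finset.mul_sum, ← Finset.sum_add_distrib]
      refine Finset.sum_congr rfl fun s _ => ?_
      rw [dtau_const_mul _ ((hp s).fun_mul (hd s)), dtau_mul (hp s) (hd s),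
        dtau_im_zpow _ hz]
      have e1 : (z.im : ℂ) ^ ((s : ℤ) - n - 1) = (z.im : ℂ) ^ (s - n : ℤ) * (z.im : ℂ)⁻¹ :=
        zpow_sub_one₀ hy _
      have e2 : (s : ℤ) - (n + 1 : ℕ) = s - n - 1 := by push_cast; ring
      have e3 : ((s + 1 : ℕ) : ℤ) - (n + 1 : ℕ) = s - n := by push_cast; ring
      rw [e2, e3, e1]
      change _ = (raiseCoeff κ n s * (2 * Complex.I) ^ (s + 1) : ℂ) *
        ((z.im : ℂ) ^ (s - n : ℤ) * dtau (dtauIter s f) z) + _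
      push_cast
      rw [pow_succ]
      generalize (z.im : ℂ) ^ (s - n : ℤ) = p
      generalize (2 * Complex.I) ^ s = q
      linear_combination (-raiseCoeff κ n s * q * (s - n) * p * (z.im : ℂ)⁻¹
        * dtauIter s f z : ℂ) * Complex.I_sq
    rw [hstep, Finset.sum_add_distrib, Finset.sum_range_succ' _ (n + 1),
      Finset.sum_range_succ' (fun s => (((κ + n + s) * raiseCoeff κ n s : ℝ) *
        (2 * Complex.I) ^ s : ℂ) * ((z.im : ℂ) ^ (s - (n + 1 : ℕ) : ℤ) * dtauIter s f z)) n,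
      ← add_assoc]
    congr 1
    · have htop : raiseCoeff κ n (n + 1) = 0 := by simp [raiseCoeff]
      have := Finset.sum_range_succ (fun s => (((κ + n + (s + 1 : ℕ)) *
        raiseCoeff κ n (s + 1) : ℝ) * (2 * Complex.I) ^ (s + 1) : ℂ) *
        ((z.im : ℂ) ^ ((s + 1 : ℕ) - (n + 1 : ℕ) : ℤ) * dtauIter (s + 1) f z)) n
      simp only [htop, mul_zero, Complex.ofReal_zero, zero_mul, add_zero] at this
      rw [← this, ← Finset.sum_add_distrib]
      refine Finset.sum_congr rfl fun s _ => ?_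
      rw [raiseCoeff_succ_succ hκ]
      push_cast
      ring
    · rw [raiseCoeff_succ_zero hκ]
      push_cast
      ring

/-- The coefficient of `∂_τ^r f · ∂_τ^s g` in the Rankin–Cohen bracket `[f,g]_{r+s}`. -/
def rcCoeff (κ ℓ : ℝ) (r s : ℕ) : ℝ :=
  (-1) ^ r * (Real.Gamma (κ + (r + s : ℕ)) * Real.Gamma (ℓ + (r + s : ℕ))) /
    (Real.Gamma (s + 1) * Real.Gamma (κ + r) * Real.Gamma (r + 1) * Real.Gamma (ℓ + s))

theorem rcBracket_eq_sum_antidiagonal (κ ℓ : ℝ) (n : ℕ) (f g : ℂ → ℂ) :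
    rcBracket κ ℓ n f g = fun z => (2 * (Real.pi : ℂ) * Complex.I) ^ (-(n : ℤ)) *
      ∑ p ∈ Finset.HasAntidiagonal.antidiagonal n,
        (rcCoeff κ ℓ p.1 p.2 : ℂ) * (dtauIter p.1 f z * dtauIter p.2 g z) := by
  funext z
  rw [Finset.Nat.sum_antidiagonal_eq_sum_range_succ
    (fun r s => (rcCoeff κ ℓ r s : ℂ) * (dtauIter r f z * dtauIter s g z))]
  simp only [rcBracket]
  congr 1
  refine Finset.sum_congr rfl fun r hr => ?_
  have hrn : r ≤ n := Nat.lt_succ_iff.1 (Finset.mem_range.1 hr)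
  have e1 : κ + n - ((n - r : ℕ) : ℝ) = κ + r := by rw [Nat.cast_sub hrn]; ring
  have e2 : ℓ + n - r = ℓ + ((n - r : ℕ) : ℝ) := by rw [Nat.cast_sub hrn]; ring
  rw [mul_assoc, rcCoeff, Nat.add_sub_cancel' hrn, e1, e2]

theorem rcCoeff_mul_left {κ ℓ : ℝ} (hκ : 0 < κ) (r s : ℕ) :
    rcCoeff κ ℓ r s * (Real.Gamma (κ + r) / Real.Gamma κ) =
      (-1) ^ r * (Real.Gamma (κ + (r + s : ℕ)) /
        (Real.Gamma ((r + s : ℕ) + 1) * Real.Gamma κ) * raiseCoeff ℓ (r + s) s) := by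
  have h1 : Real.Gamma (κ + r) ≠ 0 := (Real.Gamma_pos_of_pos (by positivity)).ne'
  have hc : (((r + s).choose s : ℕ) : ℝ) * (r.factorial * s.factorial) =
      (r + s).factorial := by
    have h := Nat.choose_mul_factorial_mul_factorial (Nat.le_add_left s r)
    rw [Nat.add_sub_cancel] at h
    rw [← h]
    push_cast
    ring
  simp only [rcCoeff, raiseCoeff, Real.Gamma_nat_eq_factorial, ← hc]
  have h2 : (((r + s).choose s : ℕ) : ℝ) ≠ 0 := by
    exact_mod_cast (Nat.choose_pos (Nat.le_add_left s r)).ne'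
  have h3 : (r.factorial : ℝ) ≠ 0 := by exact_mod_cast r.factorial_ne_zero
  have h4 : (s.factorial : ℝ) ≠ 0 := by exact_mod_cast s.factorial_ne_zero
  field_simp

theorem rcCoeff_swap (κ ℓ : ℝ) (r s : ℕ) :
    rcCoeff κ ℓ r s = (-1) ^ (r + s) * rcCoeff ℓ κ s r := by
  have h : (-1 : ℝ) ^ (r + s) * (-1) ^ s = (-1) ^ r := by
    rw [pow_add, mul_assoc, ← mul_pow]
    simp
  simp only [rcCoeff, ← h, add_comm s r]
  ring

/-- The part of `∂_τ̄ [f,g]_n` in which `∂_τ̄` falls on the derivatives of `f`. -/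
theorem sum_rcCoeff_dtaubar {κ ℓ : ℝ} (hκ : 0 < κ) (hℓ : 0 < ℓ) (n : ℕ) {f g : ℂ → ℂ}
    (hf : ContDiffOn ℝ (⊤ : ℕ∞) f {z : ℂ | 0 < z.im})
    (hg : ContDiffOn ℝ (⊤ : ℕ∞) g {z : ℂ | 0 < z.im})
    (hΔf : ∀ z : ℂ, 0 < z.im → laplaceOp κ f z = 0) {z : ℂ} (hz : 0 < z.im) :
    (2 * Complex.I) ^ n * ∑ p ∈ Finset.HasAntidiagonal.antidiagonal n,
        (rcCoeff κ ℓ p.1 p.2 : ℂ) * (dtaubar (dtauIter p.1 f) z * dtauIter p.2 g z) =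
      ((Real.Gamma (κ + n) / (Real.Gamma (n + 1) * Real.Gamma κ) : ℝ) : ℂ) *
        dtaubar f z * raiseIter ℓ n g z := by
  rw [raiseIter_eq_sum hℓ hg n z hz,
    ← Finset.Nat.sum_antidiagonal_eq_sum_range_succ (fun s _ =>
      (raiseCoeff ℓ n s * (2 * Complex.I) ^ s : ℂ) *
        ((z.im : ℂ) ^ (s - n : ℤ) * dtauIter s g z)),
    ← Finset.Nat.sum_antidiagonal_swap, Finset.mul_sum, Finset.mul_sum]
  refine Finset.sum_congr rfl fun ⟨s, r⟩ hp => ?_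
  obtain rfl : r + s = n := (add_comm r s).trans (Finset.HasAntidiagonal.mem_antidiagonal.1 hp)
  have hc := congrArg (fun x : ℝ => (x : ℂ)) (rcCoeff_mul_left (ℓ := ℓ) hκ r s)
  have hI : (2 * Complex.I) ^ r * (Complex.I / 2) ^ r * (-1 : ℂ) ^ r = 1 := by
    rw [← mul_pow, ← mul_pow]
    have : 2 * Complex.I * (Complex.I / 2) * -1 = 1 := by
      linear_combination -Complex.I_sq
    rw [this, one_pow]
  have he : (s : ℤ) - (r + s : ℕ) = -r := by push_cast; ring
  simp only [Prod.fst_swap, Prod.snd_swap, he]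
  rw [dtaubar_dtauIter hκ hf hΔf r z hz, pow_add]
  rw [Complex.ofReal_mul, Complex.ofReal_mul ((-1 : ℝ) ^ r),
    Complex.ofReal_mul (Real.Gamma (κ + (r + s : ℕ)) / _)] at hc
  simp only [Complex.ofReal_pow, Complex.ofReal_neg, Complex.ofReal_one] at hc
  generalize ((Real.Gamma (κ + (r + s : ℕ)) /
    (Real.Gamma ((r + s : ℕ) + 1) * Real.Gamma κ) : ℝ) : ℂ) = A at hc ⊢
  generalize ((Real.Gamma (κ + r) / Real.Gamma κ : ℝ) : ℂ) = B at hc ⊢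
  generalize (z.im : ℂ) ^ (-(r : ℤ)) = y
  linear_combination ((2 * Complex.I) ^ r * (2 * Complex.I) ^ s * (Complex.I / 2) ^ r * y *
      dtaubar f z * dtauIter s g z) * hc +
    ((2 * Complex.I) ^ s * A * raiseCoeff ℓ (r + s) s * y * dtaubar f z * dtauIter s g z) * hI

/-- For `κ, ℓ > 0`, `n ∈ ℕ`, and smooth `f, g : ℍ → ℂ` with `Δ_κ f = 0`
and `Δ_ℓ g = 0`, pointwise on `ℍ`:
`(−4π)^n L_{κ+ℓ+2n}([f,g]_n) = (Γ(κ+n)/(Γ(n+1)Γ(κ))) (L_κ f)(R_ℓⁿ g)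
 + (−1)^n (Γ(ℓ+n)/(Γ(n+1)Γ(ℓ))) (R_κⁿ f)(L_ℓ g)`. -/
theorem stmt10 (κ ℓ : ℝ) (hκ : 0 < κ) (hℓ : 0 < ℓ) (n : ℕ) (f g : ℂ → ℂ)
    (hf : ContDiffOn ℝ (⊤ : ℕ∞) f {z : ℂ | 0 < z.im})
    (hg : ContDiffOn ℝ (⊤ : ℕ∞) g {z : ℂ | 0 < z.im})
    (hΔf : ∀ z : ℂ, 0 < z.im → laplaceOp κ f z = 0)
    (hΔg : ∀ z : ℂ, 0 < z.im → laplaceOp ℓ g z = 0) :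
    ∀ z : ℂ, 0 < z.im →
      (((-4 * Real.pi : ℝ) ^ n : ℝ) : ℂ) * lowerOp (κ + ℓ + 2 * n) (rcBracket κ ℓ n f g) z =
        ((Real.Gamma (κ + n) / (Real.Gamma (n + 1) * Real.Gamma κ) : ℝ) : ℂ) *
            lowerOp κ f z * raiseIter ℓ n g z +
          (((-1 : ℝ) ^ n : ℝ) : ℂ) *
            ((Real.Gamma (ℓ + n) / (Real.Gamma (n + 1) * Real.Gamma ℓ) : ℝ) : ℂ) *
            raiseIter κ n f z * lowerOp ℓ g z := by
  intro z hz
  have hd {h : ℂ → ℂ} (hh : ContDiffOn ℝ (⊤ : ℕ∞) h {z : ℂ | 0 < z.im}) (r : ℕ) :=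
    (hh.dtauIter_upperHalf r).differentiableAt_upperHalf hz
  have hE : dtaubar (rcBracket κ ℓ n f g) z =
      (2 * (Real.pi : ℂ) * Complex.I) ^ (-(n : ℤ)) *
        (∑ p ∈ Finset.HasAntidiagonal.antidiagonal n,
            (rcCoeff κ ℓ p.1 p.2 : ℂ) * (dtaubar (dtauIter p.1 f) z * dtauIter p.2 g z) +
          ∑ p ∈ Finset.HasAntidiagonal.antidiagonal n,
            (rcCoeff κ ℓ p.1 p.2 : ℂ) * (dtaubar (dtauIter p.2 g) z * dtauIter p.1 f z)) := by
    have hp (p : ℕ × ℕ) := (hd hf p.1).fun_mul (hd hg p.2)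
    rw [rcBracket_eq_sum_antidiagonal, dtaubar_const_mul _
      (DifferentiableAt.fun_sum fun p _ => (hp p).const_mul _),
      dtaubar_sum _ fun p _ => (hp p).const_mul _, ← Finset.sum_add_distrib]
    congr 1
    refine Finset.sum_congr rfl fun p _ => ?_
    rw [dtaubar_const_mul _ (hp p), dtaubar_mul (hd hf p.1) (hd hg p.2)]
    ring
  have hswap : ∑ p ∈ Finset.HasAntidiagonal.antidiagonal n,
        (rcCoeff κ ℓ p.1 p.2 : ℂ) * (dtaubar (dtauIter p.2 g) z * dtauIter p.1 f z) =
      (-1) ^ n * ∑ p ∈ Finset.HasAntidiagonal.antidiagonal n,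
        (rcCoeff ℓ κ p.1 p.2 : ℂ) * (dtaubar (dtauIter p.1 g) z * dtauIter p.2 f z) := by
    rw [← Finset.Nat.sum_antidiagonal_swap, Finset.mul_sum]
    refine Finset.sum_congr rfl fun p hp => ?_
    rw [Prod.fst_swap, Prod.snd_swap, rcCoeff_swap, add_comm p.2,
      Finset.HasAntidiagonal.mem_antidiagonal.1 hp]
    push_cast
    ring
  have hπ : (((-4 * Real.pi : ℝ) ^ n : ℝ) : ℂ) *
      (2 * (Real.pi : ℂ) * Complex.I) ^ (-(n : ℤ)) = (2 * Complex.I) ^ n := by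
    have h0 : (2 * (Real.pi : ℂ) * Complex.I) ≠ 0 := by
      simp [Real.pi_ne_zero]
    have h1 : ((-4 * Real.pi : ℝ) : ℂ) = 2 * Complex.I * (2 * Real.pi * Complex.I) := by
      push_cast
      linear_combination (-4 * Real.pi : ℂ) * Complex.I_sq
    rw [Complex.ofReal_pow, h1, mul_pow, zpow_neg, zpow_natCast,
      mul_inv_cancel_right₀ (pow_ne_zero n h0)]
  have h1 := sum_rcCoeff_dtaubar hκ hℓ n hf hg hΔf hz
  have h2 := sum_rcCoeff_dtaubar hℓ hκ n hg hf hΔg hz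
  rw [hswap] at hE
  simp only [lowerOp, hE, Complex.ofReal_pow (-1 : ℝ), Complex.ofReal_neg, Complex.ofReal_one]
  linear_combination (-2 * Complex.I * (z.im ^ 2 : ℝ)) * h1 +
    (-2 * Complex.I * (z.im ^ 2 : ℝ)) * (-1) ^ n * h2 +
    (-2 * Complex.I * (z.im ^ 2 : ℝ)) * (∑ p ∈ Finset.HasAntidiagonal.antidiagonal n,
        (rcCoeff κ ℓ p.1 p.2 : ℂ) * (dtaubar (dtauIter p.1 f) z * dtauIter p.2 g z) +
      (-1) ^ n * ∑ p ∈ Finset.HasAntidiagonal.antidiagonal n,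
        (rcCoeff ℓ κ p.1 p.2 : ℂ) * (dtaubar (dtauIter p.1 g) z * dtauIter p.2 f z)) * hπ
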